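/- Let R be a nonzero commutative ring of positive characteristic N = p₁^{α₁}⋯p_s^{α_s}, where p₁,…,p_s are distinct primes and α₁,…,α_s ≥ 1. Let f = Σ_{k=0}^{n} b_k x^k ∈ R[x] with b₀ ≠ 0, b_n ≠ 0 and n = deg(f) ≥ 1. Then f is T-periodic if and only if Σ_{j=0}^{ℓ} C(ℓ,j)·b_j ≠ 0 in R for every integer ℓ with 0 ≤ ℓ ≤ Π_{i=1}^{s} p_i^{α_i + ⌊log_{p_i}(n)⌋}, where C(ℓ,j) is the binomial coefficient. -/

import Mathlib

open Polynomial
open scoped Classical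

/-- The Collatz map on `R[x]`: `T(f) = f·(x+1) − f₀` if the constant coefficient `f₀`
of `f` is nonzero, and `T(f) = f/x` otherwise. -/
noncomputable def collatzT (R : Type*) [CommRing R] (f : R[X]) : R[X] :=
  if f.coeff 0 ≠ 0 then f * (X + 1) - C (f.coeff 0) else f.divX

theorem collatzT_of_coeff_zero_eq_zero {R : Type*} [CommRing R] {f : R[X]}
    (h : f.coeff 0 = 0) : collatzT R f = f.divX := by
  simp [collatzT, h]

theorem collatzT_collatzT_of_coeff_zero_ne_zero {R : Type*} [CommRing R] {f : R[X]}
    (h : f.coeff 0 ≠ 0) : collatzT R (collatzT R f) = f + f.divX := by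
  have h1 : collatzT R f = f * (X + 1) - C (f.coeff 0) := by simp [collatzT, h]
  rw [h1, collatzT_of_coeff_zero_eq_zero (by simp [mul_add])]
  ext k
  simp [mul_add, coeff_divX]

theorem coeff_iterate_add_divX {R : Type*} [CommRing R] (f : R[X]) (ℓ k : ℕ) :
    ((fun g : R[X] => g + g.divX)^[ℓ] f).coeff k =
      ∑ j ∈ Finset.range (ℓ + 1), (ℓ.choose j : R) * f.coeff (k + j) := by
  induction ℓ generalizing k with
  | zero => simp
  | succ ℓ ih =>
    rw [Function.iterate_succ_apply', coeff_add, coeff_divX, ih, ih,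
      Finset.sum_choose_succ_mul (fun j _ => f.coeff (k + j)) ℓ]
    simp only [add_assoc, add_comm 1]

theorem collatzT_iterate_two_mul {R : Type*} [CommRing R] (f : R[X]) (ℓ : ℕ)
    (h : ∀ i < ℓ, ((fun g : R[X] => g + g.divX)^[i] f).coeff 0 ≠ 0) :
    (collatzT R)^[2 * ℓ] f = (fun g : R[X] => g + g.divX)^[ℓ] f := by
  induction ℓ with
  | zero => rfl
  | succ ℓ ih =>
    rw [Nat.mul_succ, Function.iterate_succ_apply', Function.iterate_succ_apply',
      ih fun i hi => h i (hi.trans ℓ.lt_succ_self),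
      collatzT_collatzT_of_coeff_zero_ne_zero (h ℓ ℓ.lt_succ_self),
      Function.iterate_succ_apply']

theorem natDegree_iterate_add_divX_le {R : Type*} [CommRing R] (f : R[X]) (ℓ : ℕ) :
    ((fun g : R[X] => g + g.divX)^[ℓ] f).natDegree ≤ f.natDegree := by
  refine natDegree_le_iff_coeff_eq_zero.2 fun k hk => ?_
  rw [coeff_iterate_add_divX]
  refine Finset.sum_eq_zero fun j _ => ?_
  rw [coeff_eq_zero_of_natDegree_lt (hk.trans_le (k.le_add_right j)), mul_zero]

/-- A degree bound that is stable under the Collatz map: the degree may exceed `m` by one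
only when the constant coefficient vanishes. -/
def CollatzBounded {R : Type*} [CommRing R] (m : ℕ) (g : R[X]) : Prop :=
  g.natDegree ≤ m ∨ g.natDegree ≤ m + 1 ∧ g.coeff 0 = 0

theorem CollatzBounded.collatzT {R : Type*} [CommRing R] {m : ℕ} {g : R[X]}
    (h : CollatzBounded m g) : CollatzBounded m (collatzT R g) := by
  by_cases h0 : g.coeff 0 = 0
  · left
    rw [collatzT_of_coeff_zero_eq_zero h0, natDegree_divX_eq_natDegree_tsub_one]
    rcases h with h | h <;> omega
  · have hm : g.natDegree ≤ m := h.resolve_right fun h => h0 h.2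
    right
    have h1 : _root_.collatzT R g = g * (X + 1) - C (g.coeff 0) := by simp [_root_.collatzT, h0]
    rw [h1]
    refine ⟨?_, by simp [mul_add]⟩
    rw [natDegree_sub_C]
    have h2 : (X + 1 : R[X]).natDegree ≤ 1 := by compute_degree
    exact natDegree_mul_le.trans (add_le_add hm h2)

theorem CollatzBounded.iterate {R : Type*} [CommRing R] {m : ℕ} {g : R[X]}
    (h : CollatzBounded m g) (k : ℕ) : CollatzBounded m ((_root_.collatzT R)^[k] g) := by
  induction k with
  | zero => exact h
  | succ k ih =>
    rw [Function.iterate_succ_apply']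
    exact ih.collatzT

theorem coeff_zero_iterate_ne_zero_of_periodic {R : Type*} [CommRing R] {f : R[X]}
    (h0 : f.coeff 0 ≠ 0) (hd : 1 ≤ f.natDegree) {n : ℕ} (hn : 1 ≤ n)
    (hf : (collatzT R)^[n] f = f) (ℓ : ℕ) :
    ((fun g : R[X] => g + g.divX)^[ℓ] f).coeff 0 ≠ 0 := by
  induction ℓ using Nat.strong_induction_on with
  | _ ℓ ih =>
  intro hz
  have hb : CollatzBounded (f.natDegree - 1) ((collatzT R)^[2 * ℓ] f) := by
    rw [collatzT_iterate_two_mul f ℓ ih]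
    exact Or.inr ⟨(natDegree_iterate_add_divX_le f ℓ).trans (by omega), hz⟩
  have hle : 2 * ℓ ≤ n * (2 * ℓ) := Nat.le_mul_of_pos_left _ hn
  have hb' := hb.iterate (n * (2 * ℓ) - 2 * ℓ)
  rw [← Function.iterate_add_apply, Nat.sub_add_cancel hle, Function.iterate_mul,
    Function.iterate_fixed hf] at hb'
  rcases hb' with h | h
  · omega
  · exact h0 h.2

theorem Nat.Prime.pow_dvd_choose_of_pow_add_log_dvd {p a n M j : ℕ} (hp : p.Prime)
    (hM : p ^ (a + Nat.log p n) ∣ M) (hj : 1 ≤ j) (hjn : j ≤ n) : p ^ a ∣ M.choose j := by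
  rcases M.eq_zero_or_pos with rfl | hM0
  · rw [Nat.choose_eq_zero_of_lt hj]
    exact dvd_zero _
  rcases lt_or_ge M j with hlt | hle
  · rw [Nat.choose_eq_zero_of_lt hlt]
    exact dvd_zero _
  have hc : M.choose j ≠ 0 := (Nat.choose_pos hle).ne'
  have hmul : M ∣ M.choose j * j := by
    obtain ⟨M, rfl⟩ := Nat.exists_eq_succ_of_ne_zero hM0.ne'
    obtain ⟨j, rfl⟩ := Nat.exists_eq_succ_of_ne_zero (Nat.one_le_iff_ne_zero.1 hj)
    exact ⟨_, (Nat.add_one_mul_choose_eq M j).symm⟩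
  have h1 := (hp.pow_dvd_iff_le_factorization (mul_ne_zero hc (by omega))).1 (hM.trans hmul)
  rw [Nat.factorization_mul hc (by omega), Finsupp.add_apply] at h1
  have h2 : j.factorization p ≤ Nat.log p n :=
    (Nat.le_log_of_pow_le hp.one_lt (Nat.ordProj_le p (by omega))).trans
      (Nat.log_mono_right hjn)
  exact (hp.pow_dvd_iff_le_factorization hc).2 (by omega)

theorem iterate_add_divX_eq_self {R : Type*} [CommRing R] {f : R[X]} {M : ℕ}
    (h : ∀ j, 1 ≤ j → j ≤ f.natDegree → (M.choose j : R) = 0) :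
    (fun g : R[X] => g + g.divX)^[M] f = f := by
  ext k
  rw [coeff_iterate_add_divX, Finset.sum_range_succ', Finset.sum_eq_zero]
  · simp
  · intro j _
    rcases le_or_gt (j + 1) f.natDegree with hj | hj
    · rw [h _ (by omega) hj, zero_mul]
    · rw [coeff_eq_zero_of_natDegree_lt (by omega), mul_zero]

/-- In positive characteristic `N = ∏ pᵢ^αᵢ`, a polynomial `f = Σ bₖ xᵏ` with `b₀ ≠ 0`,
nonzero leading coefficient and `deg f ≥ 1` is `T`-periodic iff
`Σ_{j=0}^{ℓ} C(ℓ,j)·b_j ≠ 0` for all `0 ≤ ℓ ≤ ∏ pᵢ^(αᵢ + ⌊log_{pᵢ}(deg f)⌋)`. -/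
theorem stmt9 (R : Type*) [CommRing R] [Nontrivial R] (s : ℕ) (hs : 1 ≤ s)
    (p α : Fin s → ℕ) (hp : ∀ i, (p i).Prime) (hinj : Function.Injective p)
    (hα : ∀ i, 1 ≤ α i) [CharP R (∏ i, p i ^ α i)]
    (f : R[X]) (h0 : f.coeff 0 ≠ 0) (hlead : f.leadingCoeff ≠ 0) (hd : 1 ≤ f.natDegree) :
    (∃ n ≥ 1, (collatzT R)^[n] f = f) ↔
      ∀ ℓ ≤ ∏ i, p i ^ (α i + Nat.log (p i) f.natDegree),
        ∑ j ∈ Finset.range (ℓ + 1), (ℓ.choose j : R) * f.coeff j ≠ 0 := by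
  have hcoeff (ℓ : ℕ) : ∑ j ∈ Finset.range (ℓ + 1), (ℓ.choose j : R) * f.coeff j =
      ((fun g : R[X] => g + g.divX)^[ℓ] f).coeff 0 := by
    simp [coeff_iterate_add_divX]
  simp only [hcoeff]
  refine ⟨fun ⟨n, hn, hf⟩ ℓ _ => coeff_zero_iterate_ne_zero_of_periodic h0 hd hn hf ℓ,
    fun h => ?_⟩
  set M := ∏ i, p i ^ (α i + Nat.log (p i) f.natDegree)
  have hM : 0 < M := Finset.prod_pos fun i _ => pow_pos (hp i).pos _
  refine ⟨2 * M, by omega, ?_⟩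
  rw [collatzT_iterate_two_mul f M fun i hi => h i hi.le]
  refine iterate_add_divX_eq_self fun j hj hjn => ?_
  rw [CharP.cast_eq_zero_iff R (∏ i, p i ^ α i)]
  refine Finset.prod_dvd_of_isRelPrime (fun i _ k _ hik => ?_) fun i _ => ?_
  · exact Nat.coprime_iff_isRelPrime.1 (Nat.Coprime.pow _ _
      ((Nat.coprime_primes (hp i) (hp k)).2 (hinj.ne hik)))
  · exact (hp i).pow_dvd_choose_of_pow_add_log_dvd
      (Finset.dvd_prod_of_mem _ (Finset.mem_univ i)) hj hjn
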